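/- Consider an [[n,1]] stabilizer code with stabilizer group G of order 2^{n-1} (not containing −I) and logical Pauli operators X̄, Ȳ, Z̄. For any bipartition of the n qubits into A and B, exactly one of the following holds: (i) each of the three cosets X̄G, ȲG, Z̄G contains a representative supported entirely on A; (ii) each contains a representative supported entirely on B; (iii) exactly one of the three cosets contains representatives supported on A and representatives supported on B, while the other two cosets contain no representative supported entirely on A or entirely on B. -/

import Mathlib

open Matrix BigOperators Finset

/-- The four single-qubit Pauli matrices `I, X, Y, Z`. -/
noncomputable def pauli1 : Fin 4 → Matrix (Fin 2) (Fin 2) ℂ :=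
  ![(1 : Matrix (Fin 2) (Fin 2) ℂ),
    !![0, 1; 1, 0],
    !![0, -Complex.I; Complex.I, 0],
    !![1, 0; 0, -1]]

/-- The `n`-qubit Pauli string `⨂ₖ pauli1 (s k)` as a matrix on `(Fin n → Fin 2)`. -/
noncomputable def pauliString {n : ℕ} (s : Fin n → Fin 4) :
    Matrix (Fin n → Fin 2) (Fin n → Fin 2) ℂ :=
  Matrix.of fun i j => ∏ k, pauli1 (s k) (i k) (j k)

/-- `M` is a Pauli operator with phase `±1`. -/
def IsPauliPM {n : ℕ} (M : Matrix (Fin n → Fin 2) (Fin n → Fin 2) ℂ) : Prop :=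
  ∃ (ε : ℂ) (s : Fin n → Fin 4), (ε = 1 ∨ ε = -1) ∧ M = ε • pauliString s

/-- `M` is a `±1`-phase Pauli operator whose support is contained in `A`. -/
def SuppIn {n : ℕ} (A : Finset (Fin n)) (M : Matrix (Fin n → Fin 2) (Fin n → Fin 2) ℂ) : Prop :=
  ∃ (ε : ℂ) (s : Fin n → Fin 4), (ε = 1 ∨ ε = -1) ∧ M = ε • pauliString s ∧
    ∀ k ∉ A, s k = 0

/-- The element `∏_{i : f i} g i` of the group generated by the (commuting) `g i`. -/
noncomputable def grpElem {n m : ℕ} (g : Fin m → Matrix (Fin n → Fin 2) (Fin n → Fin 2) ℂ)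
    (f : Fin m → Bool) : Matrix (Fin n → Fin 2) (Fin n → Fin 2) ℂ :=
  ((List.finRange m).map (fun i => if f i then g i else 1)).prod

/-- Mixed-state stabilizer 2-Rényi entropy
`M̃₂(ρ) = −log₂( Σ_P Tr(ρP)⁴ / Σ_P Tr(ρP)² )`. -/
noncomputable def sre2 {n : ℕ} (ρ : Matrix (Fin n → Fin 2) (Fin n → Fin 2) ℂ) : ℝ :=
  - Real.logb 2 (((∑ P : Fin n → Fin 4, ((ρ * pauliString P).trace) ^ 4) /
      (∑ P : Fin n → Fin 4, ((ρ * pauliString P).trace) ^ 2)).re)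

/-- The logical coset `L⟨g⟩` has a (±1-phase) representative supported inside `A`. -/
def RepOn {n m : ℕ} (g : Fin m → Matrix (Fin n → Fin 2) (Fin n → Fin 2) ℂ)
    (A : Finset (Fin n)) (L : Matrix (Fin n → Fin 2) (Fin n → Fin 2) ℂ) : Prop :=
  ∃ f : Fin m → Bool, SuppIn A (L * grpElem g f)

/-- All three logical cosets have representatives supported inside `A`. -/
def AllRep {n m : ℕ} (g : Fin m → Matrix (Fin n → Fin 2) (Fin n → Fin 2) ℂ)
    (A : Finset (Fin n)) (Xb Yb Zb : Matrix (Fin n → Fin 2) (Fin n → Fin 2) ℂ) : Prop :=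
  RepOn g A Xb ∧ RepOn g A Yb ∧ RepOn g A Zb

/-- Exactly one of the three logical cosets has representatives supported on `A` and
representatives supported on `B`, while the other two have none supported on `A` or `B`. -/
def OneLogicalOnBoth {n m : ℕ} (g : Fin m → Matrix (Fin n → Fin 2) (Fin n → Fin 2) ℂ)
    (A B : Finset (Fin n)) (Xb Yb Zb : Matrix (Fin n → Fin 2) (Fin n → Fin 2) ℂ) : Prop :=
  (RepOn g A Xb ∧ RepOn g B Xb ∧ ¬ RepOn g A Yb ∧ ¬ RepOn g B Yb ∧
    ¬ RepOn g A Zb ∧ ¬ RepOn g B Zb) ∨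
  (RepOn g A Yb ∧ RepOn g B Yb ∧ ¬ RepOn g A Xb ∧ ¬ RepOn g B Xb ∧
    ¬ RepOn g A Zb ∧ ¬ RepOn g B Zb) ∨
  (RepOn g A Zb ∧ RepOn g B Zb ∧ ¬ RepOn g A Xb ∧ ¬ RepOn g B Xb ∧
    ¬ RepOn g A Yb ∧ ¬ RepOn g B Yb)

/-- The symplectic vector space `(𝔽₂²)ⁿ` labelling `n`-qubit Pauli operators up to phase. -/
abbrev PhaseSpace (n : ℕ) : Type := Fin n → ZMod 2 × ZMod 2

/-- The standard symplectic form on `PhaseSpace n`. -/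
def symplForm (n : ℕ) : LinearMap.BilinForm (ZMod 2) (PhaseSpace n) :=
  LinearMap.mk₂ (ZMod 2) (fun u v => ∑ k, ((u k).1 * (v k).2 + (u k).2 * (v k).1))
    (fun u u' v => by
      rw [← Finset.sum_add_distrib]
      refine Finset.sum_congr rfl fun k _ => ?_
      simp only [Pi.add_apply, Prod.fst_add, Prod.snd_add]
      ring)
    (fun c u v => by
      rw [Finset.smul_sum]
      refine Finset.sum_congr rfl fun k _ => ?_
      simp only [Pi.smul_apply, Prod.smul_fst, Prod.smul_snd, smul_eq_mul]
      ring)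
    (fun u v v' => by
      rw [← Finset.sum_add_distrib]
      refine Finset.sum_congr rfl fun k _ => ?_
      simp only [Pi.add_apply, Prod.fst_add, Prod.snd_add]
      ring)
    (fun c u v => by
      rw [Finset.smul_sum]
      refine Finset.sum_congr rfl fun k _ => ?_
      simp only [Pi.smul_apply, Prod.smul_fst, Prod.smul_snd, smul_eq_mul]
      ring)

section Symplectic

variable {n : ℕ}

theorem symplForm_apply (u v : PhaseSpace n) :
    symplForm n u v = ∑ k, ((u k).1 * (v k).2 + (u k).2 * (v k).1) := rfl

theorem symplForm_comm (u v : PhaseSpace n) : symplForm n u v = symplForm n v u := by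
  simp only [symplForm_apply]
  exact Finset.sum_congr rfl fun k _ => by ring

theorem symplForm_self (u : PhaseSpace n) : symplForm n u u = 0 := by
  rw [symplForm_apply]
  refine Finset.sum_eq_zero fun k _ => ?_
  rw [mul_comm]
  exact CharTwo.add_self_eq_zero _

theorem symplForm_isRefl : (symplForm n).IsRefl := fun u v h => by
  rwa [symplForm_comm]

theorem symplForm_single (u : PhaseSpace n) (k : Fin n) (p : ZMod 2 × ZMod 2) :
    symplForm n u (Pi.single k p) = (u k).1 * p.2 + (u k).2 * p.1 := by
  rw [symplForm_apply, Finset.sum_eq_single k]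
  · simp
  · intro j _ hj
    simp [Pi.single_eq_of_ne hj]
  · simp

theorem eq_zero_of_symplForm_single {u : PhaseSpace n} {k : Fin n}
    (h : ∀ p, symplForm n u (Pi.single k p) = 0) : u k = 0 := by
  have h₁ := h (1, 0)
  have h₂ := h (0, 1)
  simp only [symplForm_single, mul_zero, mul_one, add_zero, zero_add] at h₁ h₂
  exact Prod.ext h₂ h₁

theorem symplForm_nondegenerate : (symplForm n).Nondegenerate := by
  refine ⟨fun u hu => ?_, fun u hu => ?_⟩
  · exact funext fun k => eq_zero_of_symplForm_single fun p => hu _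
  · exact funext fun k => eq_zero_of_symplForm_single fun p => by
      rw [symplForm_comm]; exact hu _

theorem finrank_phaseSpace : Module.finrank (ZMod 2) (PhaseSpace n) = 2 * n := by
  simp [Module.finrank_pi_fintype, mul_comm]

/-- The phase-space vectors supported on `A`. -/
def supportedOn (A : Finset (Fin n)) : Submodule (ZMod 2) (PhaseSpace n) where
  carrier := {v | ∀ k ∉ A, v k = 0}
  zero_mem' := fun _ _ => rfl
  add_mem' hu hv k hk := by simp [hu k hk, hv k hk]
  smul_mem' c v hv k hk := by simp [hv k hk]

theorem symplForm_eq_zero_of_supportedOn {A : Finset (Fin n)} {u v : PhaseSpace n}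
    (hu : u ∈ supportedOn A) (hv : v ∈ supportedOn Aᶜ) : symplForm n u v = 0 := by
  rw [symplForm_apply]
  refine Finset.sum_eq_zero fun k _ => ?_
  by_cases hk : k ∈ A
  · simp [hv k (by simpa using hk)]
  · simp [hu k hk]

theorem orthogonal_sup_supportedOn_compl (S : Submodule (ZMod 2) (PhaseSpace n))
    (A : Finset (Fin n)) :
    (symplForm n).orthogonal (S ⊔ supportedOn Aᶜ) =
      (symplForm n).orthogonal S ⊓ supportedOn A := by
  ext w
  constructor
  · intro hw
    refine ⟨fun s hs => hw s (Submodule.mem_sup_left hs), fun k hk => ?_⟩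
    refine eq_zero_of_symplForm_single fun p => ?_
    rw [symplForm_comm]
    refine hw _ (Submodule.mem_sup_right fun j hj => Pi.single_eq_of_ne ?_ _)
    rintro rfl
    exact hj (by simpa using hk)
  · rintro ⟨hw, hwA⟩ _ hu
    obtain ⟨s, hs, b, hb, rfl⟩ := Submodule.mem_sup.1 hu
    rw [LinearMap.BilinForm.add_left, hw s hs, symplForm_comm b,
      symplForm_eq_zero_of_supportedOn hwA hb, add_zero]

theorem mem_sup_supportedOn_compl_iff {S : Submodule (ZMod 2) (PhaseSpace n)}
    {A : Finset (Fin n)} {p : PhaseSpace n} :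
    p ∈ S ⊔ supportedOn Aᶜ ↔
      ∀ w ∈ (symplForm n).orthogonal S, w ∈ supportedOn A → symplForm n w p = 0 := by
  rw [← LinearMap.BilinForm.orthogonal_orthogonal symplForm_nondegenerate symplForm_isRefl
    (S ⊔ supportedOn Aᶜ), orthogonal_sup_supportedOn_compl]
  exact ⟨fun h w hw hA => h w ⟨hw, hA⟩, fun h w hw => h w hw.1 hw.2⟩

theorem mem_of_symplForm_eq_zero {S : Submodule (ZMod 2) (PhaseSpace n)}
    (hS : S ≤ (symplForm n).orthogonal S) (hdim : Module.finrank (ZMod 2) S + 1 = n)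
    {x z : PhaseSpace n} (hx : x ∈ (symplForm n).orthogonal S)
    (hz : z ∈ (symplForm n).orthogonal S) (hxz : symplForm n x z = 1)
    {w : PhaseSpace n} (hw : w ∈ (symplForm n).orthogonal S)
    (hwx : symplForm n w x = 0) (hwz : symplForm n w z = 0) : w ∈ S := by
  let T := (symplForm n).orthogonal S
  let φ : PhaseSpace n →ₗ[ZMod 2] ZMod 2 × ZMod 2 :=
    ((symplForm n).flip x).prod ((symplForm n).flip z)
  have hφ : ∀ v, φ v = (symplForm n v x, symplForm n v z) := fun v => rfl
  let f : T →ₗ[ZMod 2] ZMod 2 × ZMod 2 := φ.comp T.subtype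
  have hf : LinearMap.range f = ⊤ := by
    refine LinearMap.range_eq_top.2 fun p => ?_
    refine ⟨p.1 • ⟨z, hz⟩ + p.2 • ⟨x, hx⟩, ?_⟩
    have hzx : symplForm n z x = 1 := by rw [symplForm_comm, hxz]
    simp [f, hφ, hxz, hzx, symplForm_self]
  have hker : Module.finrank (ZMod 2) (LinearMap.ker f) = Module.finrank (ZMod 2) S := by
    have h := LinearMap.finrank_range_add_finrank_ker f
    rw [hf, finrank_top, Module.finrank_prod, Module.finrank_self,
      LinearMap.BilinForm.finrank_orthogonal symplForm_nondegenerate,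
      finrank_phaseSpace] at h
    omega
  have hle : S.comap T.subtype ≤ LinearMap.ker f := fun v hv => by
    have h₁ : symplForm n v x = 0 := hx _ hv
    have h₂ : symplForm n v z = 0 := hz _ hv
    simp [f, hφ, h₁, h₂]
  have heq : S.comap T.subtype = LinearMap.ker f := by
    refine Submodule.eq_of_le_of_finrank_eq hle ?_
    rw [hker]
    exact (Submodule.comapSubtypeEquivOfLe hS).finrank_eq
  have hmem : (⟨w, hw⟩ : T) ∈ LinearMap.ker f := by simp [f, hφ, hwx, hwz]
  rw [← heq] at hmem
  exact hmem

theorem symplForm_eq_zero_of_mem_sup {S : Submodule (ZMod 2) (PhaseSpace n)}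
    (hS : S ≤ (symplForm n).orthogonal S) {A : Finset (Fin n)} {p q : PhaseSpace n}
    (hp : p ∈ S ⊔ supportedOn Aᶜ) (hq : q ∈ S ⊔ supportedOn A)
    (hpS : p ∈ (symplForm n).orthogonal S) (hqS : q ∈ (symplForm n).orthogonal S) :
    symplForm n q p = 0 := by
  obtain ⟨s, hs, a, ha, rfl⟩ := Submodule.mem_sup.1 hq
  have haS : a ∈ (symplForm n).orthogonal S := by
    simpa using Submodule.sub_mem _ hqS (hS hs)
  rw [LinearMap.BilinForm.add_left, hpS s hs, mem_sup_supportedOn_compl_iff.1 hp a haS ha,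
    add_zero]

/-- In a symplectic complement of dimension two, a nonzero class can be moved to `Aᶜ` exactly
when neither of the other two nonzero classes can be moved to `A`. -/
theorem mem_sup_supportedOn_compl_iff_of_pair {S : Submodule (ZMod 2) (PhaseSpace n)}
    (hS : S ≤ (symplForm n).orthogonal S) (hdim : Module.finrank (ZMod 2) S + 1 = n)
    {p q : PhaseSpace n} (hp : p ∈ (symplForm n).orthogonal S)
    (hq : q ∈ (symplForm n).orthogonal S) (hpq : symplForm n p q = 1) (A : Finset (Fin n)) :
    p ∈ S ⊔ supportedOn Aᶜ ↔ q ∉ S ⊔ supportedOn A ∧ p + q ∉ S ⊔ supportedOn A := by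
  have hqp : symplForm n q p = 1 := by rw [symplForm_comm, hpq]
  constructor
  · refine fun h => ⟨fun h' => ?_, fun h' => ?_⟩
    · have := symplForm_eq_zero_of_mem_sup hS h h' hp hq
      simp [hqp] at this
    · have := symplForm_eq_zero_of_mem_sup hS h h' hp (Submodule.add_mem _ hp hq)
      simp [hqp, symplForm_self] at this
  · rintro ⟨h₁, h₂⟩
    refine mem_sup_supportedOn_compl_iff.2 fun w hw hwA => ?_
    by_contra hne
    have hwp : symplForm n w p = 1 := Fin.eq_one_of_ne_zero _ hne
    by_cases hwq : symplForm n w q = 0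
    · refine h₁ ?_
      have hmem : w + q ∈ S := mem_of_symplForm_eq_zero hS hdim hp hq hpq
        (Submodule.add_mem _ hw hq)
        (by rw [LinearMap.BilinForm.add_left, hwp, hqp]; rfl)
        (by rw [LinearMap.BilinForm.add_left, hwq, symplForm_self, add_zero])
      have := Submodule.sub_mem _ (Submodule.mem_sup_left (T := supportedOn A) hmem)
        (Submodule.mem_sup_right hwA)
      simpa using this
    · refine h₂ ?_
      have hwq' : symplForm n w q = 1 := Fin.eq_one_of_ne_zero _ hwq
      have hmem : w + (p + q) ∈ S := mem_of_symplForm_eq_zero hS hdim hp hq hpq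
        (Submodule.add_mem _ hw (Submodule.add_mem _ hp hq))
        (by rw [LinearMap.BilinForm.add_left, LinearMap.BilinForm.add_left, hwp, hqp,
              symplForm_self]; rfl)
        (by rw [LinearMap.BilinForm.add_left, LinearMap.BilinForm.add_left, hwq', hpq,
              symplForm_self]; rfl)
      have := Submodule.sub_mem _ (Submodule.mem_sup_left (T := supportedOn A) hmem)
        (Submodule.mem_sup_right hwA)
      simpa using this

end Symplectic

/-- The Pauli label of a pair of bits: `(1, 0)` is `X`, `(0, 1)` is `Z` and `(1, 1)` is `Y`. -/
def pauliIndex (p : ZMod 2 × ZMod 2) : Fin 4 :=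
  if p.1 = 0 then (if p.2 = 0 then 0 else 3) else (if p.2 = 0 then 1 else 2)

theorem pauliIndex_surjective : Function.Surjective pauliIndex := by
  decide

theorem pauliIndex_eq_zero {p : ZMod 2 × ZMod 2} : pauliIndex p = 0 ↔ p = 0 := by
  revert p
  decide

/-- The character `a ↦ (-1)ᵃ` of `ZMod 2`. -/
noncomputable def signChar (a : ZMod 2) : ℂ := if a = 0 then 1 else -1

theorem eq_zero_or_eq_one_of_zmod_two (a : ZMod 2) : a = 0 ∨ a = 1 := by
  revert a
  decide

theorem signChar_zero : signChar 0 = 1 := if_pos rfl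

theorem signChar_one : signChar 1 = -1 := if_neg one_ne_zero

theorem signChar_add (a b : ZMod 2) : signChar (a + b) = signChar a * signChar b := by
  have h : (1 : ZMod 2) + 1 = 0 := rfl
  rcases eq_zero_or_eq_one_of_zmod_two a with rfl | rfl <;>
    rcases eq_zero_or_eq_one_of_zmod_two b with rfl | rfl <;>
    simp [signChar_zero, signChar_one, h]

theorem signChar_injective : Function.Injective signChar := by
  intro a b hab
  rcases eq_zero_or_eq_one_of_zmod_two a with rfl | rfl <;>
    rcases eq_zero_or_eq_one_of_zmod_two b with rfl | rfl <;>
    first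
    | rfl
    | (norm_num [signChar_zero, signChar_one] at hab)

theorem signChar_sum {ι : Type*} (s : Finset ι) (f : ι → ZMod 2) :
    signChar (∑ i ∈ s, f i) = ∏ i ∈ s, signChar (f i) := by
  classical
  induction s using Finset.induction_on with
  | empty => simp [signChar_zero]
  | insert i s hi ih => rw [Finset.sum_insert hi, Finset.prod_insert hi, signChar_add, ih]

theorem pauli1_sq (s : Fin 4) : pauli1 s * pauli1 s = 1 := by
  fin_cases s <;> ext i j <;> fin_cases i <;> fin_cases j <;>
    simp [pauli1]

theorem pauli1_mul (p q : ZMod 2 × ZMod 2) :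
    ∃ c : ℂ, pauli1 (pauliIndex p) * pauli1 (pauliIndex q) = c • pauli1 (pauliIndex (p + q)) := by
  have h : (1 : ZMod 2) + 1 = 0 := rfl
  obtain ⟨a, b⟩ := p
  obtain ⟨c, d⟩ := q
  rcases eq_zero_or_eq_one_of_zmod_two a with rfl | rfl <;>
    rcases eq_zero_or_eq_one_of_zmod_two b with rfl | rfl <;>
    rcases eq_zero_or_eq_one_of_zmod_two c with rfl | rfl <;>
    rcases eq_zero_or_eq_one_of_zmod_two d with rfl | rfl <;>
    first
    | (refine ⟨1, ?_⟩
       ext i j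
       fin_cases i <;> fin_cases j <;> simp [pauli1, pauliIndex, h] <;> done)
    | (refine ⟨Complex.I, ?_⟩
       ext i j
       fin_cases i <;> fin_cases j <;> simp [pauli1, pauliIndex, h] <;> done)
    | (refine ⟨-Complex.I, ?_⟩
       ext i j
       fin_cases i <;> fin_cases j <;> simp [pauli1, pauliIndex, h])

theorem pauli1_mul_comm (p q : ZMod 2 × ZMod 2) :
    pauli1 (pauliIndex p) * pauli1 (pauliIndex q) =
      signChar (p.1 * q.2 + p.2 * q.1) • (pauli1 (pauliIndex q) * pauli1 (pauliIndex p)) := by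
  have h : (1 : ZMod 2) + 1 = 0 := rfl
  obtain ⟨a, b⟩ := p
  obtain ⟨c, d⟩ := q
  rcases eq_zero_or_eq_one_of_zmod_two a with rfl | rfl <;>
    rcases eq_zero_or_eq_one_of_zmod_two b with rfl | rfl <;>
    rcases eq_zero_or_eq_one_of_zmod_two c with rfl | rfl <;>
    rcases eq_zero_or_eq_one_of_zmod_two d with rfl | rfl <;>
    ext i j <;> fin_cases i <;> fin_cases j <;>
    simp [pauli1, pauliIndex, h, signChar_zero, signChar_one]

section PauliStrings

variable {n : ℕ}

theorem pauliString_mul_apply (s t : Fin n → Fin 4) (i j : Fin n → Fin 2) :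
    (pauliString s * pauliString t) i j = ∏ k, (pauli1 (s k) * pauli1 (t k)) (i k) (j k) := by
  simp only [Matrix.mul_apply, pauliString, Matrix.of_apply, ← Finset.prod_mul_distrib]
  exact (Fintype.prod_sum fun k x => pauli1 (s k) (i k) x * pauli1 (t k) x (j k)).symm

theorem pauliString_zero : pauliString (0 : Fin n → Fin 4) = 1 := by
  ext i j
  simp [pauliString, pauli1, Matrix.one_apply, Finset.prod_ite_zero, funext_iff]

theorem pauliString_sq (s : Fin n → Fin 4) : pauliString s * pauliString s = 1 := by
  rw [← pauliString_zero]
  ext i j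
  rw [pauliString_mul_apply]
  simp only [pauli1_sq]
  rfl

/-- The Pauli string labelled by a phase-space vector. -/
noncomputable def pauliOf (v : PhaseSpace n) : Matrix (Fin n → Fin 2) (Fin n → Fin 2) ℂ :=
  pauliString fun k => pauliIndex (v k)

theorem pauliOf_zero : pauliOf (0 : PhaseSpace n) = 1 := pauliString_zero

theorem pauliOf_sq (v : PhaseSpace n) : pauliOf v * pauliOf v = 1 := pauliString_sq _

theorem exists_pauliString_eq_pauliOf (s : Fin n → Fin 4) :
    ∃ v : PhaseSpace n, (∀ k, pauliIndex (v k) = s k) ∧ pauliString s = pauliOf v := by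
  choose v hv using fun k => pauliIndex_surjective (s k)
  exact ⟨v, hv, by simp only [pauliOf, hv]⟩

theorem pauliOf_mul (u v : PhaseSpace n) :
    ∃ c : ℂ, pauliOf u * pauliOf v = c • pauliOf (u + v) := by
  choose c hc using fun k => pauli1_mul (u k) (v k)
  refine ⟨∏ k, c k, ?_⟩
  ext i j
  rw [pauliOf, pauliOf, pauliString_mul_apply]
  simp [hc, pauliOf, pauliString, Finset.prod_mul_distrib]

theorem pauliOf_mul_comm (u v : PhaseSpace n) :
    pauliOf u * pauliOf v = signChar (symplForm n u v) • (pauliOf v * pauliOf u) := by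
  ext i j
  rw [Matrix.smul_apply, pauliOf, pauliOf, pauliString_mul_apply, pauliString_mul_apply,
    symplForm_apply, signChar_sum, smul_eq_mul, ← Finset.prod_mul_distrib]
  refine Finset.prod_congr rfl fun k _ => ?_
  rw [pauli1_mul_comm (u k), Matrix.smul_apply, smul_eq_mul]

/-- `M` is an involutive multiple of the Pauli string labelled by `v`. -/
def HasPauliLabel (M : Matrix (Fin n → Fin 2) (Fin n → Fin 2) ℂ) (v : PhaseSpace n) : Prop :=
  M * M = 1 ∧ ∃ c : ℂ, M = c • pauliOf v

variable {M N : Matrix (Fin n → Fin 2) (Fin n → Fin 2) ℂ} {u v : PhaseSpace n}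

theorem smul_one_matrix_injective {a b : ℂ}
    (h : a • (1 : Matrix (Fin n → Fin 2) (Fin n → Fin 2) ℂ) = b • 1) : a = b := by
  simpa using congrFun (congrFun h 0) 0

theorem HasPauliLabel.of_sign {ε : ℂ} (hε : ε = 1 ∨ ε = -1) (v : PhaseSpace n) :
    HasPauliLabel (ε • pauliOf v) v := by
  refine ⟨?_, ε, rfl⟩
  rcases hε with rfl | rfl <;> simp [pauliOf_sq]

theorem HasPauliLabel.exists_sign (h : HasPauliLabel M v) :
    ∃ ε : ℂ, (ε = 1 ∨ ε = -1) ∧ M = ε • pauliOf v := by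
  obtain ⟨hM, c, rfl⟩ := h
  refine ⟨c, ?_, rfl⟩
  rw [Matrix.smul_mul, Matrix.mul_smul, pauliOf_sq, smul_smul] at hM
  refine mul_self_eq_one_iff.1 (smul_one_matrix_injective (n := n) ?_)
  rw [hM, one_smul]

theorem HasPauliLabel.eq_one_or_eq_neg_one (h : HasPauliLabel M 0) : M = 1 ∨ M = -1 := by
  obtain ⟨ε, rfl | rfl, rfl⟩ := h.exists_sign <;> simp [pauliOf_zero]

theorem hasPauliLabel_one : HasPauliLabel (1 : Matrix (Fin n → Fin 2) (Fin n → Fin 2) ℂ) 0 :=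
  ⟨one_mul 1, 1, by rw [pauliOf_zero, one_smul]⟩

theorem IsPauliPM.exists_hasPauliLabel (h : IsPauliPM M) :
    ∃ v : PhaseSpace n, HasPauliLabel M v := by
  obtain ⟨ε, s, hε, rfl⟩ := h
  obtain ⟨v, -, hv⟩ := exists_pauliString_eq_pauliOf s
  exact ⟨v, hv ▸ HasPauliLabel.of_sign hε v⟩

theorem HasPauliLabel.exists_mul_eq_smul (hM : HasPauliLabel M u) (hN : HasPauliLabel N v) :
    ∃ c : ℂ, M * N = c • pauliOf (u + v) := by
  obtain ⟨-, a, rfl⟩ := hM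
  obtain ⟨-, b, rfl⟩ := hN
  obtain ⟨c, hc⟩ := pauliOf_mul u v
  exact ⟨a * b * c, by rw [Matrix.smul_mul, Matrix.mul_smul, hc, smul_smul, smul_smul, mul_assoc]⟩

theorem HasPauliLabel.mul (hM : HasPauliLabel M u) (hN : HasPauliLabel N v)
    (hMN : M * N = N * M) : HasPauliLabel (M * N) (u + v) := by
  refine ⟨?_, hM.exists_mul_eq_smul hN⟩
  calc M * N * (M * N) = M * N * (N * M) := by rw [hMN]
    _ = M * (N * N) * M := by simp only [mul_assoc]
    _ = 1 := by rw [hN.1, mul_one, hM.1]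

theorem HasPauliLabel.I_smul_mul (hM : HasPauliLabel M u) (hN : HasPauliLabel N v)
    (hMN : M * N = -(N * M)) : HasPauliLabel (Complex.I • (M * N)) (u + v) := by
  refine ⟨?_, ?_⟩
  · have h : M * N * (M * N) = -1 := by
      calc M * N * (M * N) = M * N * -(N * M) := by rw [hMN]
        _ = -(M * (N * N) * M) := by simp only [mul_neg, mul_assoc]
        _ = -1 := by rw [hN.1, mul_one, hM.1]
    rw [Matrix.smul_mul, Matrix.mul_smul, h, smul_smul, Complex.I_mul_I, neg_one_smul, neg_neg]
  · obtain ⟨c, hc⟩ := hM.exists_mul_eq_smul hN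
    exact ⟨Complex.I * c, by rw [hc, smul_smul]⟩

theorem HasPauliLabel.mul_comm_smul (hM : HasPauliLabel M u) (hN : HasPauliLabel N v) :
    M * N = signChar (symplForm n u v) • (N * M) := by
  obtain ⟨-, a, rfl⟩ := hM
  obtain ⟨-, b, rfl⟩ := hN
  simp only [Matrix.smul_mul, Matrix.mul_smul]
  rw [pauliOf_mul_comm u v]
  simp only [smul_smul]
  ring_nf

theorem HasPauliLabel.signChar_eq (hM : HasPauliLabel M u) (hN : HasPauliLabel N v) {c : ℂ}
    (h : M * N = c • (N * M)) : signChar (symplForm n u v) = c := by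
  rw [hM.mul_comm_smul hN] at h
  have h' := congrArg (fun K => K * (M * N)) h
  have hNM : N * M * (M * N) = 1 := by
    rw [mul_assoc, ← mul_assoc M, hM.1, one_mul, hN.1]
  simp only [Matrix.smul_mul, hNM] at h'
  exact smul_one_matrix_injective h'

theorem HasPauliLabel.symplForm_eq_zero (hM : HasPauliLabel M u) (hN : HasPauliLabel N v)
    (h : M * N = N * M) : symplForm n u v = 0 :=
  signChar_injective <| by
    rw [signChar_zero]
    exact hM.signChar_eq hN (by rw [one_smul, h])

theorem HasPauliLabel.symplForm_eq_one (hM : HasPauliLabel M u) (hN : HasPauliLabel N v)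
    (h : M * N = -(N * M)) : symplForm n u v = 1 :=
  signChar_injective <| by
    rw [signChar_one]
    exact hM.signChar_eq hN (by rw [neg_one_smul, h])

theorem HasPauliLabel.unique (hu : HasPauliLabel M u) (hv : HasPauliLabel M v) : u = v := by
  refine sub_eq_zero.1 (symplForm_nondegenerate.1 _ fun t => ?_)
  have ht : HasPauliLabel (pauliOf t) t := ⟨pauliOf_sq t, 1, (one_smul _ _).symm⟩
  rw [LinearMap.BilinForm.sub_left, sub_eq_zero]
  exact signChar_injective (hu.signChar_eq ht (hv.mul_comm_smul ht))

theorem HasPauliLabel.suppIn_iff (h : HasPauliLabel M v) (A : Finset (Fin n)) :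
    SuppIn A M ↔ v ∈ supportedOn A := by
  constructor
  · rintro ⟨ε, s, hε, rfl, hs⟩ k hk
    obtain ⟨w, hw, hsw⟩ := exists_pauliString_eq_pauliOf s
    rw [hsw] at h
    rw [h.unique (HasPauliLabel.of_sign hε w), ← pauliIndex_eq_zero, hw, hs k hk]
  · intro hv
    obtain ⟨ε, hε, hM⟩ := h.exists_sign
    exact ⟨ε, _, hε, hM, fun k hk => pauliIndex_eq_zero.2 (hv k hk)⟩

end PauliStrings

section StabilizerGroup

variable {n m : ℕ} {g : Fin m → Matrix (Fin n → Fin 2) (Fin n → Fin 2) ℂ}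
  {L : Matrix (Fin n → Fin 2) (Fin n → Fin 2) ℂ} {v : Fin m → PhaseSpace n} {l : PhaseSpace n}

theorem commute_prod_map_ite (hL : ∀ i, L * g i = g i * L) (f : Fin m → Bool)
    (is : List (Fin m)) : Commute L (is.map fun i => if f i then g i else 1).prod := by
  refine Commute.list_prod_right _ _ fun x hx => ?_
  obtain ⟨i, -, rfl⟩ := List.mem_map.1 hx
  split_ifs
  · exact hL i
  · exact Commute.one_right L

theorem mul_grpElem_comm (hL : ∀ i, L * g i = g i * L) (f : Fin m → Bool) :
    L * grpElem g f = grpElem g f * L :=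
  commute_prod_map_ite hL f _

theorem grpElem_false : grpElem g (fun _ => false) = 1 := by
  simp [grpElem]

theorem hasPauliLabel_grpElem (hcomm : ∀ i i', g i * g i' = g i' * g i)
    (hv : ∀ i, HasPauliLabel (g i) (v i)) (f : Fin m → Bool) :
    HasPauliLabel (grpElem g f) (∑ i, if f i then v i else 0) := by
  rw [Fin.sum_univ_def, grpElem]
  induction List.finRange m with
  | nil => exact hasPauliLabel_one
  | cons i is ih =>
    rw [List.map_cons, List.map_cons, List.prod_cons, List.sum_cons]
    by_cases hi : f i = true
    · simp only [hi, if_true]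
      exact (hv i).mul ih (commute_prod_map_ite (hcomm i) f is)
    · simp only [hi]
      simpa using ih

theorem smul_eq_ite_decide (c : ZMod 2) (w : PhaseSpace n) :
    c • w = if decide (c = 1) = true then w else 0 := by
  rcases eq_zero_or_eq_one_of_zmod_two c with rfl | rfl <;> simp

theorem mem_span_range_iff_exists_bool {w : PhaseSpace n} :
    w ∈ Submodule.span (ZMod 2) (Set.range v) ↔
      ∃ f : Fin m → Bool, ∑ i, (if f i then v i else 0) = w := by
  rw [Submodule.mem_span_range_iff_exists_fun]
  constructor
  · rintro ⟨c, rfl⟩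
    exact ⟨fun i => decide (c i = 1), Finset.sum_congr rfl fun i _ =>
      (smul_eq_ite_decide (c i) (v i)).symm⟩
  · rintro ⟨f, rfl⟩
    exact ⟨fun i => if f i then 1 else 0, Finset.sum_congr rfl fun i _ => by
      simp only [ite_smul, one_smul, zero_smul]⟩

theorem linearIndependent_of_hasPauliLabel (hcomm : ∀ i i', g i * g i' = g i' * g i)
    (hindep : ∀ f f' : Fin m → Bool, grpElem g f = grpElem g f' → f = f')
    (hnoNegI : ∀ f : Fin m → Bool, grpElem g f ≠ -1)
    (hv : ∀ i, HasPauliLabel (g i) (v i)) : LinearIndependent (ZMod 2) v := by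
  refine Fintype.linearIndependent_iff.2 fun c hc i => ?_
  have h := hasPauliLabel_grpElem hcomm hv fun i => decide (c i = 1)
  simp only [← smul_eq_ite_decide, hc] at h
  have hf := hindep _ (fun _ => false)
    ((h.eq_one_or_eq_neg_one.resolve_right (hnoNegI _)).trans grpElem_false.symm)
  have hi : c i ≠ 1 := by simpa using congrFun hf i
  exact (eq_zero_or_eq_one_of_zmod_two _).resolve_right hi

theorem repOn_iff_mem_sup (hcomm : ∀ i i', g i * g i' = g i' * g i)
    (hv : ∀ i, HasPauliLabel (g i) (v i)) (hL : ∀ i, L * g i = g i * L)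
    (hl : HasPauliLabel L l) (A : Finset (Fin n)) :
    RepOn g A L ↔ l ∈ Submodule.span (ZMod 2) (Set.range v) ⊔ supportedOn A := by
  have key : ∀ f, SuppIn A (L * grpElem g f) ↔
      l + ∑ i, (if f i then v i else 0) ∈ supportedOn A := fun f =>
    (hl.mul (hasPauliLabel_grpElem hcomm hv f) (mul_grpElem_comm hL f)).suppIn_iff A
  constructor
  · rintro ⟨f, hf⟩
    refine Submodule.mem_sup.2 ⟨-∑ i, (if f i then v i else 0), Submodule.neg_mem _
      (mem_span_range_iff_exists_bool.2 ⟨f, rfl⟩), _, (key f).1 hf, ?_⟩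
    abel
  · intro h
    obtain ⟨s, hs, a, ha, rfl⟩ := Submodule.mem_sup.1 h
    obtain ⟨f, hf⟩ := mem_span_range_iff_exists_bool.1 (Submodule.neg_mem _ hs)
    refine ⟨f, (key f).2 ?_⟩
    rw [hf]
    simpa using ha

end StabilizerGroup

/-- tripartite logical structure of an [[n,1]] stabilizer code: for any
bipartition `A, Aᶜ` of the `n = m+1` qubits, exactly one of the following holds:
(i) all three logical cosets have representatives supported on `A`; (ii) all three have
representatives supported on `Aᶜ`; (iii) exactly one coset has representatives supported
on `A` and on `Aᶜ`, while the other two have no representative supported entirely on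
`A` or entirely on `Aᶜ`. -/
theorem stmt_6 {n m : ℕ} (hnm : n = m + 1)
    (g : Fin m → Matrix (Fin n → Fin 2) (Fin n → Fin 2) ℂ)
    (Xb Zb Yb : Matrix (Fin n → Fin 2) (Fin n → Fin 2) ℂ)
    (hg : ∀ i, IsPauliPM (g i))
    (hcomm : ∀ i i', g i * g i' = g i' * g i)
    (hindep : ∀ f f' : Fin m → Bool, grpElem g f = grpElem g f' → f = f')
    (hnoNegI : ∀ f : Fin m → Bool, grpElem g f ≠ -1)
    (hXb : IsPauliPM Xb) (hZb : IsPauliPM Zb)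
    (hXcomm : ∀ i, Xb * g i = g i * Xb) (hZcomm : ∀ i, Zb * g i = g i * Zb)
    (hanti : Xb * Zb = -(Zb * Xb))
    (hXnot : ∀ (f : Fin m → Bool) (ε : ℂ), (ε = 1 ∨ ε = -1) → Xb ≠ ε • grpElem g f)
    (hZnot : ∀ (f : Fin m → Bool) (ε : ℂ), (ε = 1 ∨ ε = -1) → Zb ≠ ε • grpElem g f)
    (hYb : Yb = Complex.I • (Xb * Zb))
    (A : Finset (Fin n)) :
    (AllRep g A Xb Yb Zb ∧ ¬ AllRep g Aᶜ Xb Yb Zb ∧ ¬ OneLogicalOnBoth g A Aᶜ Xb Yb Zb) ∨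
    (¬ AllRep g A Xb Yb Zb ∧ AllRep g Aᶜ Xb Yb Zb ∧ ¬ OneLogicalOnBoth g A Aᶜ Xb Yb Zb) ∨
    (¬ AllRep g A Xb Yb Zb ∧ ¬ AllRep g Aᶜ Xb Yb Zb ∧ OneLogicalOnBoth g A Aᶜ Xb Yb Zb) := by
  choose v hv using fun i => (hg i).exists_hasPauliLabel
  obtain ⟨x, hx⟩ := hXb.exists_hasPauliLabel
  obtain ⟨z, hz⟩ := hZb.exists_hasPauliLabel
  have hy : HasPauliLabel Yb (x + z) := hYb ▸ hx.I_smul_mul hz hanti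
  have hYcomm : ∀ i, Yb * g i = g i * Yb := fun i => by
    rw [hYb, Matrix.smul_mul, Matrix.mul_smul, mul_assoc, hZcomm, ← mul_assoc, hXcomm, mul_assoc]
  let S := Submodule.span (ZMod 2) (Set.range v)
  have hdim : Module.finrank (ZMod 2) S + 1 = n := by
    rw [finrank_span_eq_card (linearIndependent_of_hasPauliLabel hcomm hindep hnoNegI hv),
      Fintype.card_fin, hnm]
  have hperp : ∀ {L l}, HasPauliLabel L l → (∀ i, L * g i = g i * L) →
      l ∈ (symplForm n).orthogonal S := by
    intro L l hl hL s hs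
    obtain ⟨f, rfl⟩ := mem_span_range_iff_exists_bool.1 hs
    rw [symplForm_comm]
    exact hl.symplForm_eq_zero (hasPauliLabel_grpElem hcomm hv f) (mul_grpElem_comm hL f)
  have hS : S ≤ (symplForm n).orthogonal S :=
    Submodule.span_le.2 (Set.range_subset_iff.2 fun i => hperp (hv i) (hcomm i))
  have hxS := hperp hx hXcomm
  have hzS := hperp hz hZcomm
  have hxz : symplForm n x z = 1 := hx.symplForm_eq_one hz hanti
  have hzx : symplForm n z x = 1 := by rw [symplForm_comm, hxz]
  have hyx : symplForm n (x + z) x = 1 := by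
    rw [LinearMap.BilinForm.add_left, symplForm_self, hzx, zero_add]
  have hyxz : x + z + x = z := by
    rw [add_right_comm, ZModModule.add_self, zero_add]
  have hX := mem_sup_supportedOn_compl_iff_of_pair hS hdim hxS hzS hxz A
  have hZ := mem_sup_supportedOn_compl_iff_of_pair hS hdim hzS hxS hzx A
  have hY := mem_sup_supportedOn_compl_iff_of_pair hS hdim (Submodule.add_mem _ hxS hzS) hxS hyx A
  rw [add_comm z x] at hZ
  rw [hyxz] at hY
  have hxz_add : x ∈ S ⊔ supportedOn A → z ∈ S ⊔ supportedOn A → x + z ∈ S ⊔ supportedOn A :=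
    Submodule.add_mem _
  have hxy_add : x ∈ S ⊔ supportedOn A → x + z ∈ S ⊔ supportedOn A → z ∈ S ⊔ supportedOn A :=
    fun h h' => by simpa using Submodule.sub_mem _ h' h
  have hzy_add : z ∈ S ⊔ supportedOn A → x + z ∈ S ⊔ supportedOn A → x ∈ S ⊔ supportedOn A :=
    fun h h' => by simpa using Submodule.sub_mem _ h' h
  simp only [AllRep, OneLogicalOnBoth, repOn_iff_mem_sup hcomm hv hXcomm hx,
    repOn_iff_mem_sup hcomm hv hYcomm hy, repOn_iff_mem_sup hcomm hv hZcomm hz]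
  simp only [S] at *
  rw [hX, hY, hZ]
  by_cases ax : x ∈ Submodule.span (ZMod 2) (Set.range v) ⊔ supportedOn A <;>
    by_cases ay : x + z ∈ Submodule.span (ZMod 2) (Set.range v) ⊔ supportedOn A <;>
    by_cases az : z ∈ Submodule.span (ZMod 2) (Set.range v) ⊔ supportedOn A <;>
    simp_all
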